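/- arXiv:1112.0040 — 4 statements merged into one kernel-verified Lean document; each statement's English description precedes it below -/
import Mathlib

section
/- For every natural number n, the category [n] is a retract of the n-fold product category [1] × ⋯ × [1] (n factors): there exist functors i : [n] ⥤ ([1])^n and r : ([1])^n ⥤ [n] such that i ⋙ r is the identity functor of [n]. -/
open CategoryTheory

/-- The monotone map `[n] → [1]^n` sending `k` to the indicator of the first `k` coordinates. -/
def simplexToCube (n : ℕ) : Fin (n + 1) →o (Fin n → Fin 2) where
  toFun k j := if (j : ℕ) < k then 1 else 0
  monotone' k l h j := by
    have : (k : ℕ) ≤ l := h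
    dsimp only
    split_ifs <;> omega

/-- The monotone map `[1]^n → [n]` sending a vertex of the cube to the sum of its coordinates. -/
def cubeToSimplex (n : ℕ) : (Fin n → Fin 2) →o Fin (n + 1) where
  toFun x := ⟨∑ j, (x j : ℕ), Nat.lt_succ_of_le <| by
    simpa using Finset.sum_le_card_nsmul Finset.univ (fun j => (x j : ℕ)) 1
      fun j _ => Nat.le_of_lt_succ (x j).isLt⟩
  monotone' _ _ h := Fin.mk_le_mk.2 <| Finset.sum_le_sum fun j _ => h j

theorem cubeToSimplex_simplexToCube (n : ℕ) (k : Fin (n + 1)) :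
    cubeToSimplex n (simplexToCube n k) = k := by
  have h (j : Fin n) : ((if (j : ℕ) < k then 1 else 0 : Fin 2) : ℕ) =
      if (j : ℕ) < k then 1 else 0 := by
    split_ifs <;> rfl
  ext
  change ∑ j : Fin n, ((if (j : ℕ) < k then 1 else 0 : Fin 2) : ℕ) = k
  simp only [h, Finset.sum_boole, Nat.cast_id, Fin.card_filter_val_lt]
  omega

/-- For every natural number `n`, the category `[n]` is a retract of the
`n`-fold product category `[1] × ⋯ × [1]`: there are functors `i : [n] ⥤ ([1])^n` and
`r : ([1])^n ⥤ [n]` with `i ⋙ r = 𝟭 [n]`.  Here `[n]` is the finite linear order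
`{0 < 1 < ⋯ < n}`, modelled as `Fin (n+1)`, and the `n`-fold product of copies of `[1]`
is modelled as the product category `Fin n → Fin 2`. -/
theorem simplex_retract_of_cube (n : ℕ) :
    ∃ (i : Fin (n + 1) ⥤ (Fin n → Fin 2)) (r : (Fin n → Fin 2) ⥤ Fin (n + 1)),
      i ⋙ r = 𝟭 (Fin (n + 1)) := by
  let i : Fin (n + 1) ⥤ (Fin n → Fin 2) :=
    { obj := simplexToCube n
      map f j := homOfLE ((simplexToCube n).monotone (leOfHom f) j) }
  let r : (Fin n → Fin 2) ⥤ Fin (n + 1) :=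
    { obj := cubeToSimplex n
      map f := homOfLE ((cubeToSimplex n).monotone fun j => leOfHom (f j)) }
  exact ⟨i, r, CategoryTheory.Functor.ext (cubeToSimplex_simplexToCube n)
    fun _ _ _ => Subsingleton.elim _ _⟩
end

section
/- Let m, k ≥ 1. Let f : [m] ⥤ [1] be the (monotone) functor with f(0) = 0 and f(a) = 1 for all a ≥ 1, and let g : [k] ⥤ [1] be the functor with g(b) = 0 for all b < k and g(k) = 1. Then the strict pullback of f and g — the category whose objects are pairs (a, b) with f(a) = g(b) and whose morphisms are pairs of morphisms lying over the same morphism of [1] — is isomorphic to the category [m + k − 1]. (In particular, [n] is an iterated fiber product of copies of [2] over [1].) -/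
open CategoryTheory

universe v₁ v₂ v₃ u₁ u₂ u₃

/-- The strict pullback of functors `F : A ⥤ C` and `G : B ⥤ C`: objects are pairs `(a, b)`
with `F a = G b`, and morphisms `(a, b) ⟶ (a', b')` are pairs of morphisms `(u, v)` such that
`F u` and `G v` agree as morphisms of `C` (modulo the canonical identifications `eqToHom`). -/
def StrictPullback {A : Type u₁} {B : Type u₂} {C : Type u₃}
    [Category.{v₁} A] [Category.{v₂} B] [Category.{v₃} C]
    (F : A ⥤ C) (G : B ⥤ C) : Type max u₁ u₂ :=
  {p : A × B // F.obj p.1 = G.obj p.2}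

instance StrictPullback.category {A : Type u₁} {B : Type u₂} {C : Type u₃}
    [Category.{v₁} A] [Category.{v₂} B] [Category.{v₃} C]
    (F : A ⥤ C) (G : B ⥤ C) : Category (StrictPullback F G) where
  Hom x y := {uv : (x.1.1 ⟶ y.1.1) × (x.1.2 ⟶ y.1.2) //
    F.map uv.1 ≫ eqToHom y.2 = eqToHom x.2 ≫ G.map uv.2}
  id x := ⟨⟨𝟙 _, 𝟙 _⟩, by simp⟩
  comp {x y z} f g := ⟨⟨f.1.1 ≫ g.1.1, f.1.2 ≫ g.1.2⟩, by
    rw [Functor.map_comp, Category.assoc, g.2, ← Category.assoc, f.2,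
      Category.assoc, ← Functor.map_comp]⟩
  id_comp f := Subtype.ext (Prod.ext (Category.id_comp _) (Category.id_comp _))
  comp_id f := Subtype.ext (Prod.ext (Category.comp_id _) (Category.comp_id _))
  assoc f g h := Subtype.ext (Prod.ext (Category.assoc _ _ _) (Category.assoc _ _ _))

namespace StrictPullback

section Thin

variable {A : Type u₁} {B : Type u₂} {C : Type u₃} [Category.{v₁} A] [Category.{v₂} B]
  [Category.{v₃} C] {F : A ⥤ C} {G : B ⥤ C}

/-- Morphisms in the strict pullback of thin categories are unique. -/
instance isThin [Quiver.IsThin A] [Quiver.IsThin B] : Quiver.IsThin (StrictPullback F G) :=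
  fun _ _ => ⟨fun _ _ => Subtype.ext (Prod.ext (Subsingleton.elim _ _) (Subsingleton.elim _ _))⟩

/-- Over a thin category, any pair of morphisms is a morphism of the strict pullback. -/
def homMk [Quiver.IsThin C] {x y : StrictPullback F G} (u : x.1.1 ⟶ y.1.1)
    (v : x.1.2 ⟶ y.1.2) : x ⟶ y :=
  ⟨(u, v), Subsingleton.elim _ _⟩

end Thin

section Preorder

variable {A : Type u₁} {B : Type u₂} {C : Type u₃} {D : Type*} [Preorder A] [Preorder B]
  [Preorder C] [Preorder D] {F : A ⥤ C} {G : B ⥤ C}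

/-- A componentwise monotone map out of the strict pullback of preorders, as a functor. -/
def functorOfLE (φ : StrictPullback F G → D)
    (hφ : ∀ x y : StrictPullback F G, x.1.1 ≤ y.1.1 → x.1.2 ≤ y.1.2 → φ x ≤ φ y) :
    StrictPullback F G ⥤ D where
  obj := φ
  map {x y} w := homOfLE (hφ x y (leOfHom w.1.1) (leOfHom w.1.2))

/-- A componentwise monotone map into the strict pullback of preorders, as a functor. -/
def liftOfMonotone (ψ : D → StrictPullback F G) (h₁ : Monotone fun d => (ψ d).1.1)
    (h₂ : Monotone fun d => (ψ d).1.2) : D ⥤ StrictPullback F G where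
  obj := ψ
  map w := homMk (homOfLE (h₁ (leOfHom w))) (homOfLE (h₂ (leOfHom w)))
  map_id _ := Subsingleton.elim _ _
  map_comp _ _ := Subsingleton.elim _ _

end Preorder

end StrictPullback

/-- Let `m, k ≥ 1`.  Let `f : [m] ⥤ [1]` be the functor with `f 0 = 0` and
`f a = 1` for `a ≥ 1`, and let `g : [k] ⥤ [1]` be the functor with `g b = 0` for `b < k` and
`g k = 1`.  Then the strict pullback of `f` and `g` is isomorphic to the category
`[m + k - 1]` (which has `m + k` objects, modelled as `Fin (m + k)`). -/
theorem strictPullback_of_cells_iso_simplex (m k : ℕ) (hm : 1 ≤ m) (hk : 1 ≤ k)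
    (f : Fin (m + 1) ⥤ Fin 2) (g : Fin (k + 1) ⥤ Fin 2)
    (hf : ∀ a : Fin (m + 1), f.obj a = if a = 0 then 0 else 1)
    (hg : ∀ b : Fin (k + 1), g.obj b = if b = Fin.last k then 1 else 0) :
    ∃ (e : StrictPullback f g ⥤ Fin (m + k)) (e' : Fin (m + k) ⥤ StrictPullback f g),
      e ⋙ e' = 𝟭 (StrictPullback f g) ∧ e' ⋙ e = 𝟭 (Fin (m + k)) := by
  have key (x : StrictPullback f g) :
      (x.1.1.val = 0 ∧ x.1.2.val < k) ∨ (0 < x.1.1.val ∧ x.1.2.val = k) := by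
    have h := x.2
    rw [hf, hg] at h
    have h₂ := x.1.2.isLt
    simp only [Fin.ext_iff, Fin.val_zero, Fin.val_last] at h
    split_ifs at h with h₀ h₁ h₁ <;> simp at h <;> omega
  let φ (x : StrictPullback f g) : Fin (m + k) :=
    ⟨x.1.1.val - 1 + x.1.2.val, by have := x.1.1.isLt; have := key x; omega⟩
  let ψ (i : Fin (m + k)) : StrictPullback f g :=
    ⟨(⟨i.val + 1 - k, by omega⟩, ⟨min i.val k, by omega⟩), by
      rw [hf, hg]
      simp only [Fin.ext_iff, Fin.val_zero, Fin.val_last]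
      split_ifs <;> first | rfl | omega⟩
  refine ⟨StrictPullback.functorOfLE φ ?_, StrictPullback.liftOfMonotone ψ ?_ ?_,
    CategoryTheory.Functor.ext (fun x => ?_) (fun _ _ _ => Subsingleton.elim _ _),
    CategoryTheory.Functor.ext (fun i => ?_) (fun _ _ _ => Subsingleton.elim _ _)⟩
  · intro x y h₁ h₂
    simp only [φ, Fin.le_def] at *
    omega
  · intro i j h
    simp only [ψ, Fin.le_def] at *
    omega
  · intro i j h
    simp only [ψ, Fin.le_def] at *
    omega
  · have := key x
    refine Subtype.ext (Prod.ext (Fin.ext ?_) (Fin.ext ?_))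
    · change x.1.1.val - 1 + x.1.2.val + 1 - k = x.1.1.val
      omega
    · change min (x.1.1.val - 1 + x.1.2.val) k = x.1.2.val
      omega
  · refine Fin.ext ?_
    change i.val + 1 - k - 1 + min i.val k = i.val
    omega
end

section
/- For every category X, the assignment F ↦ F(0→1) defines a bijection between the set of functors F : [3] ⥤ X that send the morphisms 0 → 2 and 1 → 3 of [3] to identity morphisms of X (in particular F(0) = F(2) and F(1) = F(3)), and the set of isomorphisms of X (triples (a, b, φ) with a, b objects of X and φ : a ≅ b an isomorphism). -/
open CategoryTheory

universe v u

/-- A functor out of `[3]` sending `0 ⟶ 2` and `1 ⟶ 3` to identities is the sequence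
`a ⟶ b ⟶ a ⟶ b` formed by an isomorphism, its inverse, and the isomorphism again. -/
theorem ComposableArrows.exists_iso_eq_mk₃ {X : Type u} [Category.{v} X]
    (F : ComposableArrows X 3)
    (h₀₂ : ∃ h : F.obj 0 = F.obj 2,
      F.map (homOfLE (by decide : (0 : Fin 4) ≤ 2)) = eqToHom h)
    (h₁₃ : ∃ h : F.obj 1 = F.obj 3,
      F.map (homOfLE (by decide : (1 : Fin 4) ≤ 3)) = eqToHom h) :
    ∃ (a b : X) (e : a ≅ b), F = ComposableArrows.mk₃ e.hom e.inv e.hom := by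
  obtain ⟨a, b, a', b', f, g, k, rfl⟩ := F.mk₃_surjective
  obtain ⟨h, hfg⟩ := h₀₂
  obtain ⟨h', hgk⟩ := h₁₃
  change a = a' at h
  change b = b' at h'
  subst h h'
  change f ≫ g = 𝟙 a at hfg
  change g ≫ k = 𝟙 b at hgk
  obtain rfl : f = k := by
    rw [← Category.comp_id f, ← hgk, ← Category.assoc, hfg, Category.id_comp]
  exact ⟨a, b, ⟨f, g, hfg, hgk⟩, rfl⟩

/-- For every category `X`, the assignment `F ↦ F(0 → 1)` gives a bijection
between the set of functors `F : [3] ⥤ X` sending the morphisms `0 → 2` and `1 → 3` of `[3]`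
to identity morphisms of `X`, and the set of isomorphisms of `X`, i.e. triples `(a, b, φ)`
with `φ : a ⟶ b` invertible.  We phrase this as: the assignment (valued in triples
`(a, b, f)` with `f : a ⟶ b`) is injective, and its range is exactly the set of triples
whose morphism component is an isomorphism. -/
theorem functors_from_three_with_collapsed_edges_biject_with_isos
    (X : Type u) [Category.{v} X] :
    Function.Injective
      (fun F : {F : Fin 4 ⥤ X //
          (∃ h : F.obj 0 = F.obj 2,
            F.map (homOfLE (by decide : (0 : Fin 4) ≤ 2)) = eqToHom h) ∧
          (∃ h : F.obj 1 = F.obj 3,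
            F.map (homOfLE (by decide : (1 : Fin 4) ≤ 3)) = eqToHom h)} =>
        (⟨F.1.obj 0, F.1.obj 1, F.1.map (homOfLE (by decide : (0 : Fin 4) ≤ 1))⟩ :
          Σ (a : X) (b : X), a ⟶ b)) ∧
    Set.range
      (fun F : {F : Fin 4 ⥤ X //
          (∃ h : F.obj 0 = F.obj 2,
            F.map (homOfLE (by decide : (0 : Fin 4) ≤ 2)) = eqToHom h) ∧
          (∃ h : F.obj 1 = F.obj 3,
            F.map (homOfLE (by decide : (1 : Fin 4) ≤ 3)) = eqToHom h)} =>
        (⟨F.1.obj 0, F.1.obj 1, F.1.map (homOfLE (by decide : (0 : Fin 4) ≤ 1))⟩ :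
          Σ (a : X) (b : X), a ⟶ b)) =
      {t : Σ (a : X) (b : X), a ⟶ b | IsIso t.2.2} := by
  constructor
  · rintro ⟨F, hF₀₂, hF₁₃⟩ ⟨G, hG₀₂, hG₁₃⟩ hFG
    obtain ⟨a, b, e, rfl⟩ := ComposableArrows.exists_iso_eq_mk₃ F hF₀₂ hF₁₃
    obtain ⟨a', b', e', rfl⟩ := ComposableArrows.exists_iso_eq_mk₃ G hG₀₂ hG₁₃
    change (⟨a, b, e.hom⟩ : Σ (a : X) (b : X), a ⟶ b) = ⟨a', b', e'.hom⟩ at hFG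
    obtain ⟨rfl, hFG⟩ := Sigma.mk.inj hFG
    obtain ⟨rfl, hFG⟩ := Sigma.mk.inj (eq_of_heq hFG)
    obtain rfl : e = e' := Iso.ext (eq_of_heq hFG)
    rfl
  · ext ⟨a, b, f⟩
    constructor
    · rintro ⟨⟨F, hF₀₂, hF₁₃⟩, hF⟩
      obtain ⟨a', b', e, rfl⟩ := ComposableArrows.exists_iso_eq_mk₃ F hF₀₂ hF₁₃
      rw [← hF]
      exact inferInstanceAs (IsIso e.hom)
    · intro (hf : IsIso f)
      exact ⟨⟨ComposableArrows.mk₃ f (inv f) f,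
        ⟨rfl, IsIso.hom_inv_id f⟩, ⟨rfl, IsIso.inv_hom_id f⟩⟩, rfl⟩
end

section
/- A category X is gaunt if and only if every functor F : [3] ⥤ X that sends the morphisms 0 → 2 and 1 → 3 of [3] to identity morphisms of X sends every morphism of [3] to an identity morphism (equivalently, F is constant at a single object of X). -/
open CategoryTheory

universe v u

/-- A category is *gaunt* if every isomorphism in it is an identity morphism. -/
def IsGaunt (C : Type u) [Category.{v} C] : Prop :=
  ∀ ⦃X Y : C⦄ (e : X ≅ Y), ∃ h : X = Y, e.hom = eqToHom h

/-- The two-out-of-six property for isomorphisms. -/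
theorem isIso_of_two_out_of_six {C : Type u} [Category.{v} C] {W X Y Z : C}
    (f : W ⟶ X) (g : X ⟶ Y) (h : Y ⟶ Z) [IsIso (f ≫ g)] [IsIso (g ≫ h)] :
    IsIso f ∧ IsIso g ∧ IsIso h := by
  have : Mono g := mono_of_mono g h
  have : IsSplitEpi g := ⟨⟨inv (f ≫ g) ≫ f, by simp⟩⟩
  have : IsIso g := isIso_of_mono_of_isSplitEpi g
  exact ⟨IsIso.of_isIso_comp_right f g, this, IsIso.of_isIso_comp_left g h⟩

/-- A functor out of `[3]` inverting `0 → 2` and `1 → 3` inverts every morphism. -/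
theorem isIso_map_of_isIso_zero_two_of_isIso_one_three {C : Type u} [Category.{v} C]
    (F : Fin 4 ⥤ C) [IsIso (F.map (homOfLE (by decide : (0 : Fin 4) ≤ 2)))]
    [IsIso (F.map (homOfLE (by decide : (1 : Fin 4) ≤ 3)))] {a b : Fin 4} (e : a ⟶ b) :
    IsIso (F.map e) := by
  let f : (0 : Fin 4) ⟶ 1 := homOfLE (by decide)
  let g : (1 : Fin 4) ⟶ 2 := homOfLE (by decide)
  let h : (2 : Fin 4) ⟶ 3 := homOfLE (by decide)
  have : IsIso (F.map f ≫ F.map g) := by rwa [← F.map_comp]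
  have : IsIso (F.map g ≫ F.map h) := by rwa [← F.map_comp]
  obtain ⟨hf, hg, hh⟩ := isIso_of_two_out_of_six (F.map f) (F.map g) (F.map h)
  have from_zero : ∀ c : Fin 4, IsIso (F.map (homOfLE (Fin.zero_le c))) := by
    intro c
    fin_cases c
    · exact inferInstanceAs (IsIso (F.map (𝟙 _)))
    · exact hf
    · assumption
    · have : IsIso (F.map (f ≫ g ≫ h)) := by
        simp only [F.map_comp]
        infer_instance
      exact this
  have := from_zero a
  have : IsIso (F.map (homOfLE (Fin.zero_le a)) ≫ F.map e) := by
    rw [← F.map_comp]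
    exact from_zero b
  exact IsIso.of_isIso_comp_left (F.map (homOfLE (Fin.zero_le a))) (F.map e)

/-- A category `X` is gaunt if and only if every functor `F : [3] ⥤ X`
sending the morphisms `0 → 2` and `1 → 3` of `[3]` to identity morphisms of `X` sends every
morphism of `[3]` to an identity morphism of `X`. -/
theorem isGaunt_iff_functors_from_three_collapse (X : Type u) [Category.{v} X] :
    IsGaunt X ↔
      ∀ F : Fin 4 ⥤ X,
        (∃ h : F.obj 0 = F.obj 2,
          F.map (homOfLE (by decide : (0 : Fin 4) ≤ 2)) = eqToHom h) →
        (∃ h : F.obj 1 = F.obj 3,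
          F.map (homOfLE (by decide : (1 : Fin 4) ≤ 3)) = eqToHom h) →
        ∀ (a b : Fin 4) (e : a ⟶ b), ∃ h : F.obj a = F.obj b, F.map e = eqToHom h := by
  constructor
  · rintro hX F ⟨_, h₀₂⟩ ⟨_, h₁₃⟩ a b e
    have : IsIso (F.map (homOfLE (by decide : (0 : Fin 4) ≤ 2))) := by
      rw [h₀₂]
      infer_instance
    have : IsIso (F.map (homOfLE (by decide : (1 : Fin 4) ≤ 3))) := by
      rw [h₁₃]
      infer_instance
    have := isIso_map_of_isIso_zero_two_of_isIso_one_three F e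
    exact hX (asIso (F.map e))
  · intro H Y Z e
    exact H (ComposableArrows.mk₃ e.hom e.inv e.hom)
      ⟨rfl, e.hom_inv_id⟩ ⟨rfl, e.inv_hom_id⟩ 0 1 (homOfLE (by decide))
end
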